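/- Let k ∈ ℤ, m,n ∈ ℕ, and let x ∈ A(S^7_q) ⊗_B A(S^7_q) satisfy χ(x) = 1 ⊗ r^{k,m,n}. Then χ(q^{2+(|k|−k)/2} z_1* x z_2 − q^{3+(|k|−k)/2} z_2 x z_1* + q^{1+(|k|+k)/2} z_3 x z_4* − q^{(|k|+k)/2} z_4* x z_3) = 1 ⊗ r^{k,m+1,n}, where products are taken in the A(S^7_q)-bimodule A(S^7_q) ⊗_B A(S^7_q). -/

import Mathlib

open scoped TensorProduct

noncomputable section

namespace QIB

/-- Generators of `A(U_q(4))`: the matrix entries `t i j` and the extra generator `D_q⁻¹`. -/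
abbrev genU : Type := (Fin 4 × Fin 4) ⊕ Unit

abbrev FU : Type := FreeAlgebra ℂ genU

def T (i j : Fin 4) : FU := FreeAlgebra.ι ℂ (Sum.inl (i, j))

def Dinv0 : FU := FreeAlgebra.ι ℂ (Sum.inr ())

/-- The length (number of inversions) of a permutation of `Fin 4`. -/
def plen (σ : Equiv.Perm (Fin 4)) : ℕ :=
  ((Finset.univ : Finset (Fin 4 × Fin 4)).filter fun p => p.1 < p.2 ∧ σ p.2 < σ p.1).card

/-- The quantum determinant, as an element of the free algebra. -/
def Dq0 (q : ℝ) : FU :=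
  ∑ σ : Equiv.Perm (Fin 4),
    ((-(q : ℂ)) ^ plen σ) • (T (σ 0) 0 * T (σ 1) 1 * T (σ 2) 2 * T (σ 3) 3)

/-- The defining relations of `A(U_q(4))`. -/
inductive relU (q : ℝ) : FU → FU → Prop
  | col {i j k : Fin 4} : i < j → relU q (T i k * T j k) ((q : ℂ) • (T j k * T i k))
  | row {i j k : Fin 4} : i < j → relU q (T k i * T k j) ((q : ℂ) • (T k j * T k i))
  | comm {i j k l : Fin 4} : i < j → k < l → relU q (T i l * T j k) (T j k * T i l)
  | qcom {i j k l : Fin 4} : i < j → k < l →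
      relU q (T i k * T j l - T j l * T i k) (((q : ℂ) - (q : ℂ)⁻¹) • (T j k * T i l))
  | dr : relU q (Dq0 q * Dinv0) 1
  | dl : relU q (Dinv0 * Dq0 q) 1

variable (q : ℝ)

/-- The algebra `A(U_q(4))`. -/
abbrev AU : Type := RingQuot (relU q)

/-- The generators `t i j` of `A(U_q(4))` (indices are 0-based). -/
def tt (i j : Fin 4) : AU q := RingQuot.mkAlgHom ℂ (relU q) (T i j)

/-- The generator `D_q⁻¹`. -/
def dI : AU q := RingQuot.mkAlgHom ℂ (relU q) Dinv0

/-- The quantum determinant `D_q` in `A(U_q(4))`. -/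
def Dq : AU q := RingQuot.mkAlgHom ℂ (relU q) (Dq0 q)

/-- The spanning set `R` of relation elements (0-based indices). -/
def Rset : Set (AU q) :=
  {tt q 0 2, tt q 2 0, tt q 0 3, tt q 3 0, tt q 1 3, tt q 3 1, tt q 1 2, tt q 2 1,
   tt q 0 0 - tt q 3 3, tt q 0 1 + tt q 3 2, tt q 1 0 + tt q 2 3, tt q 1 1 - tt q 2 2,
   tt q 0 0 * tt q 1 1 - (q : ℂ) • (tt q 0 1 * tt q 1 0) - 1}

/-- The right ideal `ℛ = R · A(U_q(4))`, as a `ℂ`-submodule. -/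
def RIdeal : Submodule ℂ (AU q) :=
  Submodule.span ℂ {y | ∃ x ∈ Rset q, ∃ a : AU q, y = x * a}

/-- The coalgebra `C = A(U_q(4)) / ℛ`. -/
abbrev Cq : Type := AU q ⧸ RIdeal q

/-- The canonical projection `r : A(U_q(4)) → C`. -/
def rr : AU q →ₗ[ℂ] Cq q := (RIdeal q).mkQ

lemma RIdeal_mul_right {y : AU q} (hy : y ∈ RIdeal q) (c : AU q) : y * c ∈ RIdeal q := by
  induction hy using Submodule.span_induction with
  | mem x hx =>
      obtain ⟨x0, hx0, a, rfl⟩ := hx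
      exact Submodule.subset_span ⟨x0, hx0, a * c, by rw [mul_assoc]⟩
  | zero => simp
  | add u v _ _ hu hv => simpa [add_mul] using (RIdeal q).add_mem hu hv
  | smul a u _ hu => simpa [smul_mul_assoc] using (RIdeal q).smul_mem a hu

/-- Auxiliary map for the right `A(U_q(4))`-module structure of `C`:
right multiplication by `c` descends to the quotient. -/
def cactAux (c : AU q) : Cq q →ₗ[ℂ] Cq q :=
  Submodule.liftQ (RIdeal q) ((RIdeal q).mkQ ∘ₗ LinearMap.mulRight ℂ c)
    (by
      intro y hy
      simp only [LinearMap.mem_ker, LinearMap.comp_apply, LinearMap.mulRight_apply,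
        Submodule.mkQ_apply, Submodule.Quotient.mk_eq_zero]
      exact RIdeal_mul_right q hy c)

@[simp] lemma cactAux_mk (c a : AU q) :
    cactAux q c (Submodule.Quotient.mk a) = (Submodule.Quotient.mk (a * c) : Cq q) := by
  simp [cactAux]

/-- The right `A(U_q(4))`-module structure `r(t) · t' := r(t t')` of `C`,
as a bilinear map `A(U_q(4)) →ₗ C →ₗ C`, `(c, x) ↦ x · c`. -/
def cact : AU q →ₗ[ℂ] Cq q →ₗ[ℂ] Cq q where
  toFun c := cactAux q c
  map_add' c c' := by
    refine LinearMap.ext fun x => ?_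
    obtain ⟨a, rfl⟩ := Submodule.Quotient.mk_surjective _ x
    simp only [cactAux_mk, mul_add, Submodule.Quotient.mk_add, LinearMap.add_apply]
  map_smul' s c := by
    refine LinearMap.ext fun x => ?_
    obtain ⟨a, rfl⟩ := Submodule.Quotient.mk_surjective _ x
    simp only [cactAux_mk, mul_smul_comm, Submodule.Quotient.mk_smul, RingHom.id_apply, LinearMap.smul_apply]

@[simp] lemma cact_mk (c a : AU q) : cact q c (rr q a) = rr q (a * c) := by
  simp [cact, rr]

/-- θ(k) = 1 for k ≥ 0 and 0 for k < 0. -/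
def thetaZ (k : ℤ) : ℂ := if 0 ≤ k then 1 else 0

/-- The linear basis elements `r^{k,m,n}` of `C`, given as representatives in `A(U_q(4))`. -/
def bas (k : ℤ) (m n : ℕ) : AU q :=
  if 0 ≤ k then tt q 0 0 ^ k.toNat * tt q 0 1 ^ m * tt q 1 0 ^ n
  else tt q 0 1 ^ m * tt q 1 0 ^ n * tt q 1 1 ^ (-k).toNat

/-! ### The quantum seven-sphere -/

/-- Generators of `A(S⁷_q)`: `(i, false)` is `z_i`, `(i, true)` is `z_i^*`. -/
abbrev genS : Type := Fin 4 × Bool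

abbrev FS : Type := FreeAlgebra ℂ genS

def Z0 (i : Fin 4) : FS := FreeAlgebra.ι ℂ (i, false)

def Zs0 (i : Fin 4) : FS := FreeAlgebra.ι ℂ (i, true)

/-- The defining relations of the ∗-algebra `A(S⁷_q)` (including the ∗-conjugate of the
first family of relations, so that the relation set is closed under the involution). -/
inductive relS (q : ℝ) : FS → FS → Prop
  | zz {i j : Fin 4} : i < j → relS q (Z0 i * Z0 j) ((q : ℂ) • (Z0 j * Z0 i))
  | ss {i j : Fin 4} : i < j → relS q (Zs0 j * Zs0 i) ((q : ℂ) • (Zs0 i * Zs0 j))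
  | sz {i j : Fin 4} : i ≠ j → relS q (Zs0 j * Z0 i) ((q : ℂ) • (Z0 i * Zs0 j))
  | szz {k : Fin 4} : relS q (Zs0 k * Z0 k)
      (Z0 k * Zs0 k + (1 - (q : ℂ) ^ 2) •
        ∑ j ∈ Finset.univ.filter (· < k), Z0 j * Zs0 j)
  | sum1 : relS q (∑ k : Fin 4, Z0 k * Zs0 k) 1

/-- The algebra `P = A(S⁷_q)`. -/
abbrev PA : Type := RingQuot (relS q)

/-- The generators `z_i` of `A(S⁷_q)` (0-based index). -/
def z (i : Fin 4) : PA q := RingQuot.mkAlgHom ℂ (relS q) (Z0 i)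

/-- The generators `z_i^*` of `A(S⁷_q)` (0-based index). -/
def zs (i : Fin 4) : PA q := RingQuot.mkAlgHom ℂ (relS q) (Zs0 i)

/-- The element `R = z₁ z₁^* + z₂ z₂^*` of `A(S⁷_q)`. -/
def RRe [StarRing (PA q)] : PA q := z q 0 * star (z q 0) + z q 1 * star (z q 1)

/-- The element `a = z₁ z₄^* − z₂ z₃^*` of `A(S⁷_q)`. -/
def aa [StarRing (PA q)] : PA q := z q 0 * star (z q 3) - z q 1 * star (z q 2)

/-- The element `b = z₁ z₃ + q⁻¹ z₂ z₄` of `A(S⁷_q)`. -/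
def bb : PA q := z q 0 * z q 2 + (q : ℂ)⁻¹ • (z q 1 * z q 3)

/-- The elements `a_n = z₁ z₄^* − qⁿ z₂ z₃^*` of `A(S⁷_q)`. -/
def aN [StarRing (PA q)] (n : ℤ) : PA q :=
  z q 0 * star (z q 3) - ((q : ℂ) ^ n) • (z q 1 * star (z q 2))

/-- The elements `b_n = z₁ z₃ + q^{n−1} z₂ z₄` of `A(S⁷_q)`. -/
def bN (n : ℤ) : PA q := z q 0 * z q 2 + ((q : ℂ) ^ (n - 1)) • (z q 1 * z q 3)

/-! ### The coaction, the coinvariants and the canonical map -/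

variable (δ : PA q →ₐ[ℂ] PA q ⊗[ℂ] AU q)

/-- `Δ_r := (id ⊗ r) ∘ Δ : A(S⁷_q) → A(S⁷_q) ⊗ C`, built from the
`A(U_q(4))`-coaction `δ`. -/
def Dr : PA q →ₗ[ℂ] PA q ⊗[ℂ] Cq q :=
  (LinearMap.lTensor (PA q) (rr q)) ∘ₗ δ.toLinearMap

/-- The set of coinvariants `B = A(Σ⁴_q) = {a | Δ_r(a) = a ⊗ r(1)}`. -/
def Bset : Set (PA q) := {a : PA q | Dr q δ a = a ⊗ₜ[ℂ] rr q 1}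

/-- The subspace of `P ⊗ P` spanned by the elements `(u b) ⊗ v − u ⊗ (b v)` with `b`
a coinvariant; quotienting by it produces the balanced tensor product `P ⊗_B P`. -/
def relT : Submodule ℂ (PA q ⊗[ℂ] PA q) :=
  Submodule.span ℂ
    {x : PA q ⊗[ℂ] PA q | ∃ u v b : PA q, b ∈ Bset q δ ∧
      x = (u * b) ⊗ₜ[ℂ] v - u ⊗ₜ[ℂ] (b * v)}

instance : AddCommGroup (PA q ⊗[ℂ] PA q) := TensorProduct.addCommGroup

/-- The balanced tensor product `P ⊗_B P` over the coinvariant subalgebra `B = A(Σ⁴_q)`. -/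
abbrev PBP : Type := (PA q ⊗[ℂ] PA q) ⧸ relT q δ

/-- The canonical projection `P ⊗ P → P ⊗_B P`. -/
def mkT : PA q ⊗[ℂ] PA q →ₗ[ℂ] PBP q δ := (relT q δ).mkQ

lemma relT_map_lmul (p : PA q) {x : PA q ⊗[ℂ] PA q} (hx : x ∈ relT q δ) :
    TensorProduct.map (LinearMap.mulLeft ℂ p) LinearMap.id x ∈ relT q δ := by
  induction hx using Submodule.span_induction with
  | mem y hy =>
      obtain ⟨u, v, b, hb, rfl⟩ := hy
      refine Submodule.subset_span ⟨p * u, v, b, hb, ?_⟩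
      simp [TensorProduct.map_tmul, mul_assoc]
  | zero => simp
  | add u v _ _ hu hv => simpa [map_add] using Submodule.add_mem _ hu hv
  | smul a u _ hu => simpa [map_smul] using Submodule.smul_mem _ a hu

lemma relT_map_rmul (p : PA q) {x : PA q ⊗[ℂ] PA q} (hx : x ∈ relT q δ) :
    TensorProduct.map LinearMap.id (LinearMap.mulRight ℂ p) x ∈ relT q δ := by
  induction hx using Submodule.span_induction with
  | mem y hy =>
      obtain ⟨u, v, b, hb, rfl⟩ := hy
      refine Submodule.subset_span ⟨u, v * p, b, hb, ?_⟩
      simp [TensorProduct.map_tmul, mul_assoc]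
  | zero => simp
  | add u v _ _ hu hv => simpa [map_add] using Submodule.add_mem _ hu hv
  | smul a u _ hu => simpa [map_smul] using Submodule.smul_mem _ a hu

/-- Left multiplication by `p ∈ P` on the bimodule `P ⊗_B P`. -/
def lact (p : PA q) : PBP q δ →ₗ[ℂ] PBP q δ :=
  Submodule.liftQ (relT q δ)
    ((relT q δ).mkQ ∘ₗ TensorProduct.map (LinearMap.mulLeft ℂ p) LinearMap.id)
    (by
      intro x hx
      simp only [LinearMap.mem_ker, LinearMap.comp_apply, Submodule.mkQ_apply,
        Submodule.Quotient.mk_eq_zero]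
      exact relT_map_lmul q δ p hx)

/-- Right multiplication by `p ∈ P` on the bimodule `P ⊗_B P`. -/
def ract (p : PA q) : PBP q δ →ₗ[ℂ] PBP q δ :=
  Submodule.liftQ (relT q δ)
    ((relT q δ).mkQ ∘ₗ TensorProduct.map LinearMap.id (LinearMap.mulRight ℂ p))
    (by
      intro x hx
      simp only [LinearMap.mem_ker, LinearMap.comp_apply, Submodule.mkQ_apply,
        Submodule.Quotient.mk_eq_zero]
      exact relT_map_rmul q δ p hx)

/-- The structure map of the right action `◁` of `A(S⁷_q)` on `A(S⁷_q) ⊗ C`: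
on simple tensors, `(u ⊗ x) ⊗ (w ⊗ y) ↦ (u w) ⊗ (x · y)`.  The action is
`(u ⊗ x) ◁ v = triMap ((u ⊗ x) ⊗ δ v) = Σ u v₍₀₎ ⊗ x · v₍₁₎`. -/
def triMap : (PA q ⊗[ℂ] Cq q) ⊗[ℂ] (PA q ⊗[ℂ] AU q) →ₗ[ℂ] PA q ⊗[ℂ] Cq q :=
  (TensorProduct.map (LinearMap.mul' ℂ (PA q)) (TensorProduct.lift (LinearMap.flip (cact q)))) ∘ₗ
    (TensorProduct.tensorTensorTensorComm ℂ (PA q) (Cq q) (PA q) (AU q)).toLinearMap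

section helpers

variable {q}

lemma t_col {i j k : Fin 4} (h : i < j) :
    tt q i k * tt q j k = (q : ℂ) • (tt q j k * tt q i k) := by
  simpa [tt, -Complex.coe_smul] using RingQuot.mkAlgHom_rel ℂ (relU.col (q := q) (k := k) h)

lemma t_row {i j k : Fin 4} (h : i < j) :
    tt q k i * tt q k j = (q : ℂ) • (tt q k j * tt q k i) := by
  simpa [tt, -Complex.coe_smul] using RingQuot.mkAlgHom_rel ℂ (relU.row (q := q) (k := k) h)

lemma t_comm {i j k l : Fin 4} (h : i < j) (h' : k < l) :
    tt q i l * tt q j k = tt q j k * tt q i l := by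
  simpa [tt] using RingQuot.mkAlgHom_rel ℂ (relU.comm (q := q) h h')

lemma t_qcom {i j k l : Fin 4} (h : i < j) (h' : k < l) :
    tt q i k * tt q j l = tt q j l * tt q i k
      + ((q : ℂ) - (q : ℂ)⁻¹) • (tt q j k * tt q i l) := by
  have := RingQuot.mkAlgHom_rel ℂ (relU.qcom (q := q) h h')
  rw [← sub_eq_iff_eq_add']
  simpa [tt] using this

/-- Index pairs in the off-diagonal blocks. -/
def Off (i j : Fin 4) : Prop := (i < 2 ∧ 2 ≤ j) ∨ (2 ≤ i ∧ j < 2)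

variable (q) in
/-- Right ideal generated by the off-diagonal blocks. -/
def JI : Submodule ℂ (AU q) :=
  Submodule.span ℂ {y | ∃ i j, Off i j ∧ ∃ a : AU q, y = tt q i j * a}

lemma J_mem {i j : Fin 4} (h : Off i j) (a : AU q) : tt q i j * a ∈ JI q :=
  Submodule.subset_span ⟨i, j, h, a, rfl⟩

lemma J_mul_right {y : AU q} (hy : y ∈ JI q) (c : AU q) : y * c ∈ JI q := by
  induction hy using Submodule.span_induction with
  | mem x hx =>
      obtain ⟨i, j, h, a, rfl⟩ := hx
      rw [mul_assoc]; exact J_mem h _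
  | zero => rw [zero_mul]; exact Submodule.zero_mem _
  | add u v _ _ hu hv => rw [add_mul]; exact (JI q).add_mem hu hv
  | smul a u _ hu => rw [smul_mul_assoc]; exact (JI q).smul_mem a hu

lemma J_le : JI q ≤ RIdeal q := by
  refine Submodule.span_le.2 ?_
  rintro y ⟨i, j, h, a, rfl⟩
  refine Submodule.subset_span ⟨tt q i j, ?_, a, rfl⟩
  unfold Off at h
  fin_cases i <;> fin_cases j <;> first | (exfalso; revert h; decide) | simp [Rset]

variable (q) in
/-- Subalgebra generated by the upper block. -/
def A0 : Subalgebra ℂ (AU q) :=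
  Algebra.adjoin ℂ {y | ∃ i j : Fin 4, i < 2 ∧ j < 2 ∧ y = tt q i j}

lemma A0_t {i j : Fin 4} (hi : i < 2) (hj : j < 2) : tt q i j ∈ A0 q :=
  Algebra.subset_adjoin ⟨i, j, hi, hj, rfl⟩

lemma gen_mul_off {a b i j : Fin 4} (ha : a < 2) (hb : b < 2) (h : Off i j) :
    tt q a b * tt q i j ∈ JI q := by
  rcases h with ⟨hi, hj⟩ | ⟨hi, hj⟩
  · have hbj : b < j := lt_of_lt_of_le hb hj
    have o : ∀ c, c < 2 → Off c j := fun c hc => Or.inl ⟨hc, hj⟩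
    rcases lt_trichotomy a i with hai | rfl | hai
    · rw [t_qcom hai hbj, ← t_comm hai hbj]
      exact add_mem (J_mem (o _ hi) _) (Submodule.smul_mem _ _ (J_mem (o _ ha) _))
    · rw [t_row hbj]
      exact Submodule.smul_mem _ _ (J_mem (o _ hi) _)
    · rw [← t_comm hai hbj]
      exact J_mem (o _ hi) _
  · have hai : a < i := lt_of_lt_of_le ha hi
    have o : ∀ c, c < 2 → Off i c := fun c hc => Or.inr ⟨hi, hc⟩
    rcases lt_trichotomy b j with hbj | rfl | hbj
    · rw [t_qcom hai hbj]
      exact add_mem (J_mem (o _ hj) _) (Submodule.smul_mem _ _ (J_mem (o _ hb) _))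
    · rw [t_col hai]
      exact Submodule.smul_mem _ _ (J_mem (o _ hj) _)
    · rw [t_comm hai hbj]
      exact J_mem (o _ hj) _

lemma A0_mul_J {b : AU q} (hb : b ∈ A0 q) : ∀ y ∈ JI q, b * y ∈ JI q := by
  induction hb using Algebra.adjoin_induction with
  | mem x hx =>
      obtain ⟨a, b, ha, hb, rfl⟩ := hx
      intro y hy
      induction hy using Submodule.span_induction with
      | mem x hx =>
          obtain ⟨i, j, h, c, rfl⟩ := hx
          rw [← mul_assoc]; exact J_mul_right (gen_mul_off ha hb h) _
      | zero => rw [mul_zero]; exact Submodule.zero_mem _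
      | add u v _ _ hu hv => rw [mul_add]; exact (JI q).add_mem hu hv
      | smul a u _ hu => rw [mul_smul_comm]; exact (JI q).smul_mem a hu
  | algebraMap r =>
      intro y hy
      rw [← Algebra.smul_def]; exact Submodule.smul_mem _ _ hy
  | add x y _ _ hx hy => intro w hw; rw [add_mul]; exact add_mem (hx w hw) (hy w hw)
  | mul x y _ _ hx hy => intro w hw; rw [mul_assoc]; exact hx _ (hy w hw)

lemma A0_low {b : AU q} (hb : b ∈ A0 q) :
    ∀ i j : Fin 4, 2 ≤ i → 2 ≤ j → b * tt q i j - tt q i j * b ∈ JI q := by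
  induction hb using Algebra.adjoin_induction with
  | mem x hx =>
      obtain ⟨a, b, ha, hb, rfl⟩ := hx
      intro i j hi hj
      rw [t_qcom (lt_of_lt_of_le ha hi) (lt_of_lt_of_le hb hj), add_sub_cancel_left]
      exact Submodule.smul_mem _ _ (J_mem (Or.inr ⟨hi, hb⟩) _)
  | algebraMap r =>
      intro i j _ _
      rw [Algebra.commutes, sub_self]; exact Submodule.zero_mem _
  | add x y _ _ hx hy =>
      intro i j hi hj
      have : (x + y) * tt q i j - tt q i j * (x + y)
        = (x * tt q i j - tt q i j * x) + (y * tt q i j - tt q i j * y) := by noncomm_ring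
      rw [this]; exact add_mem (hx i j hi hj) (hy i j hi hj)
  | mul x y hx' _ hx hy =>
      intro i j hi hj
      have : (x * y) * tt q i j - tt q i j * (x * y)
        = x * (y * tt q i j - tt q i j * y) + (x * tt q i j - tt q i j * x) * y := by
        rw [mul_sub, sub_mul]; simp only [mul_assoc]; abel
      rw [this]
      exact add_mem (A0_mul_J hx' _ (hy i j hi hj)) (J_mul_right (hx i j hi hj) _)

lemma rr_eq {x y : AU q} : rr q x = rr q y ↔ x - y ∈ RIdeal q := by
  unfold rr; rw [Submodule.mkQ_apply, Submodule.mkQ_apply, Submodule.Quotient.eq]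

lemma rr_R {x : AU q} (hx : x ∈ Rset q) (a : AU q) : rr q (x * a) = 0 := by
  rw [← map_zero (rr q), rr_eq, sub_zero]
  exact Submodule.subset_span ⟨x, hx, a, rfl⟩

lemma rr_off {b : AU q} (hb : b ∈ A0 q) {i j : Fin 4} (h : Off i j) (a : AU q) :
    rr q (b * tt q i j * a) = 0 := by
  rw [← map_zero (rr q), rr_eq, sub_zero, mul_assoc]
  exact J_le (A0_mul_J hb _ (J_mem h a))

lemma rr_low {b : AU q} (hb : b ∈ A0 q) {i j : Fin 4} (hi : 2 ≤ i) (hj : 2 ≤ j) (a : AU q) :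
    rr q (b * tt q i j * a) = rr q (tt q i j * (b * a)) := by
  rw [rr_eq, ← mul_assoc (tt q i j), ← sub_mul]
  exact J_le (J_mul_right (A0_low hb i j hi hj) a)

lemma r33 (a : AU q) : rr q (tt q 3 3 * a) = rr q (tt q 0 0 * a) := by
  have := rr_R (q := q) (x := tt q 0 0 - tt q 3 3) (by simp [Rset]) a
  rw [sub_mul, map_sub, sub_eq_zero] at this
  exact this.symm

lemma r22 (a : AU q) : rr q (tt q 2 2 * a) = rr q (tt q 1 1 * a) := by
  have := rr_R (q := q) (x := tt q 1 1 - tt q 2 2) (by simp [Rset]) a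
  rw [sub_mul, map_sub, sub_eq_zero] at this
  exact this.symm

lemma r32 (a : AU q) : rr q (tt q 3 2 * a) = - rr q (tt q 0 1 * a) := by
  have := rr_R (q := q) (x := tt q 0 1 + tt q 3 2) (by simp [Rset]) a
  rw [add_mul, map_add] at this
  exact (neg_eq_of_add_eq_zero_right this).symm

lemma r23 (a : AU q) : rr q (tt q 2 3 * a) = - rr q (tt q 1 0 * a) := by
  have := rr_R (q := q) (x := tt q 1 0 + tt q 2 3) (by simp [Rset]) a
  rw [add_mul, map_add] at this
  exact (neg_eq_of_add_eq_zero_right this).symm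

lemma rdet (a : AU q) :
    rr q ((tt q 0 0 * tt q 1 1 - (q : ℂ) • (tt q 0 1 * tt q 1 0)) * a) = rr q a := by
  have := rr_R (q := q) (x := tt q 0 0 * tt q 1 1 - (q : ℂ) • (tt q 0 1 * tt q 1 0) - 1)
    (by simp [Rset]) a
  rw [sub_mul, map_sub, sub_eq_zero, one_mul] at this
  exact this

/-- Generic computation: centrality of the 2x2 quantum determinant. -/
lemma det_gen {A : Type*} [Ring A] [Algebra ℂ A] (p : ℂ) (hp : p ≠ 0) (a b c d : A)
    (ab : a * b = p • (b * a)) (ac : a * c = p • (c * a)) (bd : b * d = p • (d * b))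
    (cd : c * d = p • (d * c)) (bc : b * c = c * b)
    (ad : a * d = d * a + (p - p⁻¹) • (c * b)) :
    a * (a * d - p • (b * c)) = (a * d - p • (b * c)) * a ∧
    b * (a * d - p • (b * c)) = (a * d - p • (b * c)) * b ∧
    c * (a * d - p • (b * c)) = (a * d - p • (b * c)) * c ∧
    d * (a * d - p • (b * c)) = (a * d - p • (b * c)) * d := by
  have ba : b * a = p⁻¹ • (a * b) := by rw [ab, smul_smul, inv_mul_cancel₀ hp, one_smul]
  have ca : c * a = p⁻¹ • (a * c) := by rw [ac, smul_smul, inv_mul_cancel₀ hp, one_smul]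
  have db : d * b = p⁻¹ • (b * d) := by rw [bd, smul_smul, inv_mul_cancel₀ hp, one_smul]
  have dc : d * c = p⁻¹ • (c * d) := by rw [cd, smul_smul, inv_mul_cancel₀ hp, one_smul]
  have da : d * a = a * d - (p - p⁻¹) • (b * c) := by rw [ad, bc]; simp
  have cb := bc.symm
  have ba' : ∀ x, b * (a * x) = p⁻¹ • (a * (b * x)) := fun x => by
    rw [← mul_assoc, ba, smul_mul_assoc, mul_assoc]
  have ca' : ∀ x, c * (a * x) = p⁻¹ • (a * (c * x)) := fun x => by
    rw [← mul_assoc, ca, smul_mul_assoc, mul_assoc]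
  have db' : ∀ x, d * (b * x) = p⁻¹ • (b * (d * x)) := fun x => by
    rw [← mul_assoc, db, smul_mul_assoc, mul_assoc]
  have dc' : ∀ x, d * (c * x) = p⁻¹ • (c * (d * x)) := fun x => by
    rw [← mul_assoc, dc, smul_mul_assoc, mul_assoc]
  have cb' : ∀ x, c * (b * x) = b * (c * x) := fun x => by
    rw [← mul_assoc, cb, mul_assoc]
  have da' : ∀ x, d * (a * x) = a * (d * x) - (p - p⁻¹) • (b * (c * x)) := fun x => by
    rw [← mul_assoc, da, sub_mul, smul_mul_assoc, mul_assoc, mul_assoc]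
  refine ⟨?_, ?_, ?_, ?_⟩ <;>
  · simp only [mul_sub, sub_mul, mul_smul_comm, smul_mul_assoc, mul_assoc, ba, ca, db, dc, da, cb,
      ba', ca', db', dc', cb', da', smul_sub, smul_smul]
    try (match_scalars <;> field_simp <;> try ring)

/-- The upper 2x2 determinant. -/
def dt (q : ℝ) : AU q := tt q 0 0 * tt q 1 1 - (q : ℂ) • (tt q 0 1 * tt q 1 0)

lemma A0_det (hq : (q : ℂ) ≠ 0) {b : AU q} (hb : b ∈ A0 q) : b * dt q = dt q * b := by
  obtain ⟨h1, h2, h3, h4⟩ := det_gen (q : ℂ) hq (tt q 0 0) (tt q 0 1) (tt q 1 0) (tt q 1 1)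
    (t_row (by decide)) (t_col (by decide)) (t_col (by decide)) (t_row (by decide))
    (t_comm (by decide) (by decide)) (t_qcom (by decide) (by decide))
  induction hb using Algebra.adjoin_induction with
  | mem x hx =>
      obtain ⟨i, j, hi, hj, rfl⟩ := hx
      fin_cases i <;> fin_cases j <;> first
        | (exfalso; revert hi; decide) | (exfalso; revert hj; decide)
        | exact h1 | exact h2 | exact h3 | exact h4
  | algebraMap r => exact Algebra.commutes _ _
  | add x y _ _ hx hy => rw [add_mul, mul_add, hx, hy]
  | mul x y _ _ hx hy => rw [mul_assoc, hy, ← mul_assoc, hx, mul_assoc]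

lemma rr_det (hq : (q : ℂ) ≠ 0) {b : AU q} (hb : b ∈ A0 q) (a : AU q) :
    rr q (b * dt q * a) = rr q (b * a) := by
  rw [A0_det hq hb, mul_assoc]; exact rdet _

/-- The lower 2x2 determinant. -/
def dl2 (q : ℝ) : AU q := tt q 2 2 * tt q 3 3 - (q : ℂ) • (tt q 2 3 * tt q 3 2)

lemma rr_dl2 {b : AU q} (hb : b ∈ A0 q) (a : AU q) :
    rr q (b * dl2 q * a) = rr q (b * a) := by
  have e1 : rr q (b * (tt q 2 2 * tt q 3 3) * a) = rr q (tt q 0 0 * tt q 1 1 * (b * a)) := by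
    have hb' : tt q 1 1 * b ∈ A0 q := mul_mem (A0_t (by decide) (by decide)) hb
    rw [← mul_assoc, mul_assoc _ _ a, rr_low hb (by decide) (by decide), r22, ← mul_assoc,
      ← mul_assoc, rr_low hb' (by decide) (by decide), r33]
    simp only [mul_assoc]
  have e2 : rr q (b * (tt q 2 3 * tt q 3 2) * a) = rr q (tt q 0 1 * tt q 1 0 * (b * a)) := by
    have hb' : tt q 1 0 * b ∈ A0 q := mul_mem (A0_t (by decide) (by decide)) hb
    rw [← mul_assoc, mul_assoc _ _ a, rr_low hb (by decide) (by decide), r23, ← mul_assoc,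
      ← mul_assoc, rr_low hb' (by decide) (by decide), r32, neg_neg]
    simp only [mul_assoc]
  rw [← rdet (b * a), dl2, mul_sub, sub_mul, sub_mul, map_sub, map_sub, e1, mul_smul_comm,
    smul_mul_assoc, map_smul, e2, smul_mul_assoc, map_smul]

section anti
variable (S : AU q →ₗ[ℂ] AU q)
  (hSr : ∀ i j : Fin 4, ∑ k : Fin 4, tt q i k * S (tt q k j) = if i = j then 1 else 0)
include hSr

lemma up_row {b : AU q} (hb : b ∈ A0 q) {i : Fin 4} (hi : i < 2) (j : Fin 4) :
    rr q (b * tt q i 0 * S (tt q 0 j)) + rr q (b * tt q i 1 * S (tt q 1 j))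
      = if i = j then rr q b else 0 := by
  have := congrArg (fun y => rr q (b * y)) (hSr i j)
  simp only [Fin.sum_univ_four, mul_add, map_add, ← mul_assoc] at this
  rw [rr_off hb (i := i) (j := 2) (Or.inl ⟨hi, by decide⟩),
    rr_off hb (i := i) (j := 3) (Or.inl ⟨hi, by decide⟩), add_zero,
    add_zero] at this
  rw [this]; split_ifs <;> simp

lemma low_row {b : AU q} (hb : ∀ i j, Off i j → ∀ a, rr q (b * tt q i j * a) = 0)
    {i : Fin 4} (hi : 2 ≤ i) (j : Fin 4) :
    rr q (b * tt q i 2 * S (tt q 2 j)) + rr q (b * tt q i 3 * S (tt q 3 j))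
      = if i = j then rr q b else 0 := by
  have := congrArg (fun y => rr q (b * y)) (hSr i j)
  simp only [Fin.sum_univ_four, mul_add, map_add, ← mul_assoc] at this
  rw [hb i 0 (Or.inr ⟨hi, by decide⟩), hb i 1 (Or.inr ⟨hi, by decide⟩), zero_add,
    zero_add] at this
  rw [this]; split_ifs <;> simp

lemma rr_S0 (hq : (q : ℂ) ≠ 0) {b : AU q} (hb : b ∈ A0 q) (j : Fin 4) :
    rr q (b * S (tt q 0 j)) = (if 0 = j then rr q (b * tt q 1 1) else 0)
      - (q : ℂ)⁻¹ • (if 1 = j then rr q (b * tt q 0 1) else 0) := by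
  have e1 := up_row S hSr (b := b * tt q 1 1) (mul_mem hb (A0_t (by decide) (by decide)))
    (i := 0) (by decide) j
  have e2 := up_row S hSr (b := b * tt q 0 1) (mul_mem hb (A0_t (by decide) (by decide)))
    (i := 1) (by decide) j
  rw [← e1, ← e2, ← rr_det hq hb]
  have c1 : dt q = tt q 1 1 * tt q 0 0 - (q : ℂ)⁻¹ • (tt q 0 1 * tt q 1 0) := by
    rw [dt, t_qcom (i := 0) (j := 1) (k := 0) (l := 1) (by decide) (by decide),
      t_comm (i := 0) (j := 1) (k := 0) (l := 1) (by decide) (by decide)]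
    module
  have c2 : tt q 0 1 * tt q 1 1 = (q : ℂ) • (tt q 1 1 * tt q 0 1) := t_col (by decide)
  rw [c1, mul_assoc b (tt q 0 1) (tt q 1 1), c2]
  simp only [mul_sub, sub_mul, mul_smul_comm, smul_mul_assoc, map_sub, map_smul, smul_add,
    smul_smul, inv_mul_cancel₀ hq, one_smul, mul_assoc]
  abel

lemma rr_S3 (hq : (q : ℂ) ≠ 0) {b : AU q} (hb : b ∈ A0 q) (j : Fin 4) :
    rr q (b * S (tt q 3 j)) = (if 3 = j then rr q (b * tt q 2 2) else 0)
      - (q : ℂ) • (if 2 = j then rr q (b * tt q 3 2) else 0) := by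
  have o1 : ∀ i j, Off i j → ∀ a, rr q (b * tt q 2 2 * tt q i j * a) = 0 := by
    intro i j h a
    rw [mul_assoc _ _ a, rr_low hb (by decide) (by decide), r22, ← mul_assoc, ← mul_assoc]
    exact rr_off (mul_mem (A0_t (by decide) (by decide)) hb) h a
  have o2 : ∀ i j, Off i j → ∀ a, rr q (b * tt q 3 2 * tt q i j * a) = 0 := by
    intro i j h a
    rw [mul_assoc _ _ a, rr_low hb (by decide) (by decide), r32, ← mul_assoc, ← mul_assoc,
      rr_off (mul_mem (A0_t (by decide) (by decide)) hb) h a, neg_zero]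
  have e1 := low_row S hSr o1 (i := 3) (by decide) j
  have e2 := low_row S hSr o2 (i := 2) (by decide) j
  rw [← e1, ← e2, ← rr_dl2 hb]
  have c1 : tt q 2 3 * tt q 3 2 = tt q 3 2 * tt q 2 3 := t_comm (by decide) (by decide)
  have c2 : tt q 2 2 * tt q 3 2 = (q : ℂ) • (tt q 3 2 * tt q 2 2) := t_col (by decide)
  rw [dl2, c1, mul_assoc b (tt q 2 2) (tt q 3 2), c2]
  simp only [mul_sub, sub_mul, mul_smul_comm, smul_mul_assoc, map_sub, map_smul, smul_add,
    mul_assoc]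
  abel

end anti

lemma swap_pow {A : Type*} [Ring A] [Algebra ℂ A] (p : ℂ) (a b : A)
    (h : b * a = p • (a * b)) (n : ℕ) : b * a ^ n = p ^ n • (a ^ n * b) := by
  induction n with
  | zero => simp
  | succ n ih =>
    rw [pow_succ, ← mul_assoc, ih, smul_mul_assoc, mul_assoc, h, mul_smul_comm, smul_smul,
      mul_assoc, pow_succ]

lemma bas_mem (k : ℤ) (m n : ℕ) : bas q k m n ∈ A0 q := by
  have h : ∀ i j : Fin 4, i < 2 → j < 2 → ∀ e : ℕ, tt q i j ^ e ∈ A0 q :=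
    fun i j hi hj e => pow_mem (A0_t hi hj) e
  unfold bas
  split_ifs
  · exact mul_mem (mul_mem (h _ _ (by decide) (by decide) _) (h _ _ (by decide) (by decide) _))
      (h _ _ (by decide) (by decide) _)
  · exact mul_mem (mul_mem (h _ _ (by decide) (by decide) _) (h _ _ (by decide) (by decide) _))
      (h _ _ (by decide) (by decide) _)

lemma comm01 : Commute (tt q 0 1) (tt q 1 0) := t_comm (by decide) (by decide)

lemma bas_right (hq : (q : ℂ) ≠ 0) (k : ℤ) (m n : ℕ) :
    (q : ℂ) ^ ((|k| - k) / 2) • (bas q k m n * tt q 0 1) = bas q k (m + 1) n := by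
  rcases le_or_gt 0 k with hk | hk
  · rw [abs_of_nonneg hk]
    simp only [bas, if_pos hk, sub_self, Int.zero_ediv, zpow_zero, one_smul]
    rw [mul_assoc, ← (comm01.pow_right n).eq, ← mul_assoc, mul_assoc _ (tt q 0 1 ^ m), ← pow_succ]
  · rw [abs_of_neg hk]
    simp only [bas, if_neg (not_le.2 hk)]
    have e : (-k - k) / 2 = ((-k).toNat : ℤ) := by omega
    rw [e, zpow_natCast]
    have s := swap_pow (q : ℂ) (tt q 1 1) (tt q 0 1) (t_col (by decide)) (-k).toNat
    rw [mul_assoc, ← mul_smul_comm, ← s, ← mul_assoc, mul_assoc _ (tt q 1 0 ^ n),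
      ← (comm01.pow_right n).eq, ← mul_assoc, ← pow_succ]

lemma bas_left (hq : (q : ℂ) ≠ 0) (k : ℤ) (m n : ℕ) :
    (q : ℂ) ^ ((|k| + k) / 2) • (tt q 0 1 * bas q k m n) = bas q k (m + 1) n := by
  rcases le_or_gt 0 k with hk | hk
  · rw [abs_of_nonneg hk]
    simp only [bas, if_pos hk]
    have e : (k + k) / 2 = (k.toNat : ℤ) := by omega
    rw [e, zpow_natCast]
    have h : tt q 0 1 * tt q 0 0 = (q : ℂ)⁻¹ • (tt q 0 0 * tt q 0 1) := by
      rw [t_row (i := 0) (j := 1) (by decide), smul_smul, inv_mul_cancel₀ hq, one_smul]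
    have s := swap_pow _ (tt q 0 0) (tt q 0 1) h k.toNat
    rw [← mul_assoc, ← mul_assoc, s, smul_mul_assoc, smul_mul_assoc, smul_smul, inv_pow,
      mul_inv_cancel₀ (pow_ne_zero _ hq), one_smul, mul_assoc _ (tt q 0 1), ← pow_succ']
  · rw [abs_of_neg hk]
    simp only [bas, if_neg (not_le.2 hk), neg_add_cancel, Int.zero_ediv, zpow_zero, one_smul]
    rw [← mul_assoc, ← mul_assoc, ← pow_succ']

lemma z_sz {i j : Fin 4} (h : i ≠ j) : zs q j * z q i = (q : ℂ) • (z q i * zs q j) := by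
  simpa [z, zs, -Complex.coe_smul] using RingQuot.mkAlgHom_rel ℂ (relS.sz (q := q) h)

lemma z_00 : zs q 0 * z q 0 = z q 0 * zs q 0 := by
  simpa [z, zs] using RingQuot.mkAlgHom_rel ℂ (relS.szz (q := q) (k := 0))

lemma z_33 : zs q 3 * z q 3 = z q 3 * zs q 3 + (1 - (q : ℂ) ^ 2) •
    (z q 0 * zs q 0 + z q 1 * zs q 1 + z q 2 * zs q 2) := by
  have := RingQuot.mkAlgHom_rel ℂ (relS.szz (q := q) (k := 3))
  rw [show (Finset.univ.filter (· < (3 : Fin 4))) = {0, 1, 2} by decide] at this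
  simpa [z, zs, add_assoc] using this

lemma z_sum : z q 0 * zs q 0 + z q 1 * zs q 1 + z q 2 * zs q 2 + z q 3 * zs q 3 = 1 := by
  have := RingQuot.mkAlgHom_rel ℂ (relS.sum1 (q := q))
  simpa [z, zs, Fin.sum_univ_four] using this

lemma triMap_tmul (u w : PA q) (c : Cq q) (a : AU q) :
    triMap q ((u ⊗ₜ c) ⊗ₜ (w ⊗ₜ a)) = (u * w) ⊗ₜ (cact q a c) := by
  simp [triMap]

lemma tri_gen (u : PA q) (X Y : PA q ⊗[ℂ] AU q) :
    triMap q (TensorProduct.map (LinearMap.mulLeft ℂ u) LinearMap.id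
      (LinearMap.lTensor (PA q) (rr q) X) ⊗ₜ Y) =
    TensorProduct.map (LinearMap.mulLeft ℂ u) LinearMap.id
      (LinearMap.lTensor (PA q) (rr q) (X * Y)) := by
  induction X using TensorProduct.induction_on with
  | zero => simp only [map_zero, TensorProduct.zero_tmul, zero_mul]
  | add X X' h h' => simp only [map_add, TensorProduct.add_tmul, add_mul, h, h']
  | tmul w a =>
    induction Y using TensorProduct.induction_on with
    | zero => simp only [map_zero, TensorProduct.tmul_zero, mul_zero]
    | add X X' h h' => simp only [map_add, TensorProduct.tmul_add, mul_add, h, h']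
    | tmul w' a' =>
      rw [LinearMap.lTensor_tmul, TensorProduct.map_tmul, triMap_tmul,
        Algebra.TensorProduct.tmul_mul_tmul, LinearMap.lTensor_tmul, TensorProduct.map_tmul]
      simp only [LinearMap.id_apply, cact_mk, LinearMap.mulLeft_apply, mul_assoc]

variable {δ}

lemma chi_lact (chi : PBP q δ →ₗ[ℂ] PA q ⊗[ℂ] Cq q)
    (hchi : ∀ p' p : PA q, chi (mkT q δ (p' ⊗ₜ[ℂ] p)) =
      TensorProduct.map (LinearMap.mulLeft ℂ p') LinearMap.id (Dr q δ p))
    (p : PA q) (x : PBP q δ) :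
    chi (lact q δ p x) = TensorProduct.map (LinearMap.mulLeft ℂ p) LinearMap.id (chi x) := by
  obtain ⟨y, rfl⟩ := Submodule.mkQ_surjective _ x
  induction y using TensorProduct.induction_on with
  | zero => simp only [map_zero]
  | add X X' h h' => simp only [map_add, h, h']
  | tmul u v =>
    have e : lact q δ p ((relT q δ).mkQ (u ⊗ₜ v)) = mkT q δ ((p * u) ⊗ₜ v) := rfl
    have e' : (relT q δ).mkQ (u ⊗ₜ v) = mkT q δ (u ⊗ₜ v) := rfl
    rw [e, e', hchi, hchi]
    generalize Dr q δ v = X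
    induction X using TensorProduct.induction_on with
    | zero => simp only [map_zero]
    | add X X' h h' => simp only [map_add, h, h']
    | tmul w a => simp only [TensorProduct.map_tmul, LinearMap.mulLeft_apply, mul_assoc]; rfl

lemma chi_ract (chi : PBP q δ →ₗ[ℂ] PA q ⊗[ℂ] Cq q)
    (hchi : ∀ p' p : PA q, chi (mkT q δ (p' ⊗ₜ[ℂ] p)) =
      TensorProduct.map (LinearMap.mulLeft ℂ p') LinearMap.id (Dr q δ p))
    (p : PA q) (x : PBP q δ) :
    chi (ract q δ p x) = triMap q (chi x ⊗ₜ δ p) := by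
  obtain ⟨y, rfl⟩ := Submodule.mkQ_surjective _ x
  induction y using TensorProduct.induction_on with
  | zero => simp only [map_zero, TensorProduct.zero_tmul]
  | add X X' h h' => simp only [map_add, h, h', TensorProduct.add_tmul]
  | tmul u v =>
    have e : ract q δ p ((relT q δ).mkQ (u ⊗ₜ v)) = mkT q δ (u ⊗ₜ (v * p)) := rfl
    have e' : (relT q δ).mkQ (u ⊗ₜ v) = mkT q δ (u ⊗ₜ v) := rfl
    rw [e, e', hchi, hchi]
    have := tri_gen u (δ v) (δ p)
    rw [← map_mul] at this
    exact this.symm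

lemma chi_both (chi : PBP q δ →ₗ[ℂ] PA q ⊗[ℂ] Cq q)
    (hchi : ∀ p' p : PA q, chi (mkT q δ (p' ⊗ₜ[ℂ] p)) =
      TensorProduct.map (LinearMap.mulLeft ℂ p') LinearMap.id (Dr q δ p))
    (p p' : PA q) (x : PBP q δ) (b : AU q) (hx : chi x = 1 ⊗ₜ[ℂ] rr q b)
    (w : Fin 4 → PA q) (a : Fin 4 → AU q) (hp : δ p' = ∑ j, w j ⊗ₜ[ℂ] a j) :
    chi (lact q δ p (ract q δ p' x)) = ∑ j, (p * w j) ⊗ₜ[ℂ] rr q (b * a j) := by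
  rw [chi_lact chi hchi, chi_ract chi hchi, hx, hp, TensorProduct.tmul_sum, map_sum, map_sum]
  refine Finset.sum_congr rfl fun j _ => ?_
  rw [triMap_tmul, cact_mk, TensorProduct.map_tmul, one_mul]
  rfl

end helpers

theorem tau_step_m_up (q : ℝ) (hq0 : 0 < q) (hq1 : q < 1)
    [StarRing (AU q)] [StarModule ℂ (AU q)]
    (S : AU q →ₗ[ℂ] AU q)
    (hSanti : ∀ x y : AU q, S (x * y) = S y * S x) (hS1 : S 1 = 1)
    (hSleft : ∀ i j : Fin 4, ∑ k : Fin 4, S (tt q i k) * tt q k j = if i = j then 1 else 0)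
    (hSright : ∀ i j : Fin 4, ∑ k : Fin 4, tt q i k * S (tt q k j) = if i = j then 1 else 0)
    (hSD : S (Dq q) = dI q) (hSDi : S (dI q) = Dq q)
    (hstarT : ∀ i j : Fin 4, star (tt q i j) = S (tt q j i))
    (hstarD : star (Dq q) = dI q)
    [StarRing (PA q)] [StarModule ℂ (PA q)]
    (hstarz : ∀ i : Fin 4, star (z q i) = zs q i)
    (δ : PA q →ₐ[ℂ] PA q ⊗[ℂ] AU q)
    (hδz : ∀ i : Fin 4, δ (z q i) = ∑ j : Fin 4, z q j ⊗ₜ[ℂ] tt q j i)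
    (hδzs : ∀ i : Fin 4, δ (zs q i) = ∑ j : Fin 4, zs q j ⊗ₜ[ℂ] star (tt q j i))
    (chi : PBP q δ →ₗ[ℂ] PA q ⊗[ℂ] Cq q)
    (hchi : ∀ p' p : PA q, chi (mkT q δ (p' ⊗ₜ[ℂ] p)) =
      TensorProduct.map (LinearMap.mulLeft ℂ p') LinearMap.id (Dr q δ p))
    (k : ℤ) (m n : ℕ) (x : PBP q δ)
    (hx : chi x = 1 ⊗ₜ[ℂ] rr q (bas q k m n))
        : chi (((q : ℂ) ^ (2 + (|k| - k) / 2)) • lact q δ (star (z q 0)) (ract q δ (z q 1) x)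
        - ((q : ℂ) ^ (3 + (|k| - k) / 2)) • lact q δ (z q 1) (ract q δ (star (z q 0)) x)
        + ((q : ℂ) ^ (1 + (|k| + k) / 2)) • lact q δ (z q 2) (ract q δ (star (z q 3)) x)
        - ((q : ℂ) ^ ((|k| + k) / 2)) • lact q δ (star (z q 3)) (ract q δ (z q 2) x))
      = 1 ⊗ₜ[ℂ] rr q (bas q k (m + 1) n) := by
  have hq : (q : ℂ) ≠ 0 := by exact_mod_cast hq0.ne'
  have hb := bas_mem (q := q) k m n
  simp only [hstarz]
  simp only [hstarT] at hδzs
  set b := bas q k m n with hbdef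
  set α := (|k| - k) / 2 with hα
  set β := (|k| + k) / 2 with hβ
  have oL : ∀ {i j : Fin 4}, Off i j → rr q (b * tt q i j) = 0 := fun {i j} h => by
    simpa using rr_off hb h 1
  have l1 : rr q (b * tt q 0 1) = (q : ℂ) ^ (-α) • rr q (bas q k (m + 1) n) := by
    rw [← bas_right hq, map_smul, smul_smul, ← zpow_add₀ hq, neg_add_cancel, zpow_zero, one_smul]
  have l2 : rr q (b * tt q 3 2) = -((q : ℂ) ^ (-β) • rr q (bas q k (m + 1) n)) := by
    have := rr_low hb (i := 3) (j := 2) (by decide) (by decide) 1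
    rw [mul_one, mul_one, r32] at this
    rw [this, ← bas_left hq, map_smul, smul_smul, ← zpow_add₀ hq, neg_add_cancel, zpow_zero,
      one_smul]
  have f1 := chi_both chi hchi (zs q 0) (z q 1) x b hx _ _ (hδz 1)
  have f2 := chi_both chi hchi (z q 1) (zs q 0) x b hx _ _ (hδzs 0)
  have f3 := chi_both chi hchi (z q 2) (zs q 3) x b hx _ _ (hδzs 3)
  have f4 := chi_both chi hchi (zs q 3) (z q 2) x b hx _ _ (hδz 2)
  simp only [Fin.sum_univ_four, rr_S0 S hSright hq hb, rr_S3 S hSright hq hb] at f1 f2 f3 f4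
  rw [oL (i := 2) (j := 1) (Or.inr (by decide)), oL (i := 3) (j := 1) (Or.inr (by decide)), l1,
    z_00, z_sz (i := 1) (j := 0) (by decide)] at f1
  rw [oL (i := 0) (j := 2) (Or.inl (by decide)), oL (i := 1) (j := 2) (Or.inl (by decide)), l2,
    z_33, z_sz (i := 2) (j := 3) (by decide)] at f4
  simp only [Fin.isValue, Fin.reduceEq, if_true, if_false, l1, l2, smul_zero, sub_zero, zero_sub,
    TensorProduct.tmul_zero, add_zero, zero_add] at f1 f2 f3 f4
  simp only [map_sub, map_add, map_smul, f1, f2, f3, f4]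
  rw [← z_sum (q := q)]
  simp only [TensorProduct.add_tmul, TensorProduct.smul_tmul', TensorProduct.tmul_smul,
    TensorProduct.tmul_neg, smul_add, smul_neg, zpow_add₀ hq, zpow_neg]
  simp only [← TensorProduct.smul_tmul', TensorProduct.tmul_smul]
  have ha' : (q : ℂ) ^ α ≠ 0 := zpow_ne_zero _ hq
  have hb' : (q : ℂ) ^ β ≠ 0 := zpow_ne_zero _ hq
  generalize (q : ℂ) ^ α = a at *
  generalize (q : ℂ) ^ β = c at *
  match_scalars <;> field_simp <;> push_cast <;> try ring

end QIB
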